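/- Let k be a natural number, c a real constant, and let E_1, …, E_k and α_1, …, α_{k−1} be differentiable real-valued functions of a real parameter θ. Define τ̄_i(θ) = ∑_{j<i} α_j(θ) and Θ_i(θ) = ∑_{j=i+1}^{k−1} (E_j(θ) − E_k(θ))·α_j(θ). Then the derivative of L(θ) = ∑_{i<k} (E_i(θ) − E_k(θ))·α_i(θ)·(1 + c·τ̄_i(θ)) + E_k(θ) satisfies L'(θ) = ∑_{i<k} [ ((E_i·α_i)'(θ) − E_k(θ)·α_i'(θ))·(1 + c·τ̄_i(θ)) + c·α_i'(θ)·Θ_i(θ) ] + E_k'(θ)·(1 − ∑_{i<k} α_i(θ)·(1 + c·τ̄_i(θ))). -/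

import Mathlib

open Finset

/-- Adjoint of the quadratic-transmittance image formation model
L(θ) = ∑_{i<k} (Eᵢ − E_k)·αᵢ·(1 + c·τ̄ᵢ) + E_k, with τ̄ᵢ = ∑_{j<i} αⱼ and
Θᵢ = ∑_{j=i+1}^{k−1} (Eⱼ − E_k)·αⱼ. -/
theorem quadratic_transmittance_adjoint
    (k : ℕ) (c : ℝ) (θ : ℝ) (E α : ℕ → ℝ → ℝ) (E' α' : ℕ → ℝ)
    (hE : ∀ i ≤ k, HasDerivAt (E i) (E' i) θ)
    (hα : ∀ i < k, HasDerivAt (α i) (α' i) θ)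
    (τb Θ : ℕ → ℝ → ℝ)
    (hτb : ∀ i t, τb i t = ∑ j ∈ Finset.range i, α j t)
    (hΘ : ∀ i t, Θ i t = ∑ j ∈ Finset.Ico (i + 1) k, (E j t - E k t) * α j t) :
    HasDerivAt
      (fun θ => ∑ i ∈ Finset.range k, (E i θ - E k θ) * α i θ * (1 + c * τb i θ) + E k θ)
      (∑ i ∈ Finset.range k,
          (((E' i * α i θ + E i θ * α' i) - E k θ * α' i) * (1 + c * τb i θ)
            + c * α' i * Θ i θ)
        + E' k * (1 - ∑ i ∈ Finset.range k, α i θ * (1 + c * τb i θ))) θ := by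
  have hτ : ∀ i < k, HasDerivAt (τb i) (∑ j ∈ Finset.range i, α' j) θ := by
    intro i hi
    have h : τb i = fun t => ∑ j ∈ Finset.range i, α j t := funext (hτb i)
    rw [h]
    exact HasDerivAt.fun_sum fun j hj => hα j (lt_trans (Finset.mem_range.mp hj) hi)
  have hswap : ∑ i ∈ Finset.range k, c * α' i * Θ i θ
      = ∑ j ∈ Finset.range k,
          (E j θ - E k θ) * α j θ * (c * ∑ i ∈ Finset.range j, α' i) := by
    simp only [hΘ, Finset.mul_sum]
    rw [Finset.sum_comm' (t' := Finset.range k) (s' := fun j => Finset.range j)]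
    · refine Finset.sum_congr rfl fun j _ => Finset.sum_congr rfl fun i _ => ?_
      ring
    · intro x y
      simp only [Finset.mem_range, Finset.mem_Ico]
      omega
  have main := (HasDerivAt.fun_sum (u := Finset.range k) fun i hi =>
    have hi' := Finset.mem_range.mp hi
    (((hE i hi'.le).fun_sub (hE k le_rfl)).fun_mul (hα i hi')).fun_mul
      (((hτ i hi').const_mul c).const_add 1)).fun_add (hE k le_rfl)
  refine main.congr_deriv ?_
  have h1 : ∑ i ∈ Finset.range k,
        ((E' i - E' k) * α i θ + (E i θ - E k θ) * α' i) * (1 + c * τb i θ)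
      = ∑ i ∈ Finset.range k,
          ((E' i * α i θ + E i θ * α' i) - E k θ * α' i) * (1 + c * τb i θ)
        - E' k * ∑ i ∈ Finset.range k, α i θ * (1 + c * τb i θ) := by
    rw [Finset.mul_sum, ← Finset.sum_sub_distrib]
    refine Finset.sum_congr rfl fun i _ => ?_
    ring
  rw [Finset.sum_add_distrib, Finset.sum_add_distrib, hswap, h1]
  ring
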